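/- Let k be a natural number and let p ∈ [2,∞). Define f_d(x) = (d/12)^((k+1)/2) · B_d^(k)(√(d/12)·x + d/2) and g(x) = (1/√(2π)) · (d/dx)^k exp(−x²/2). Then f_d converges to g in L^p(ℝ), i.e. ∫_ℝ |f_d(x) − g(x)|^p dx → 0 as d → ∞. -/

import Mathlib

open MeasureTheory Real Filter Finset

/-- The cardinal B-spline of order `d`: `B_1` is the indicator of `[0,1)`,
and `B_d = B_1 * B_{d-1}` (convolution) for `d ≥ 2`. -/
noncomputable def Bspline : ℕ → ℝ → ℝ
  | 0, _ => 0
  | 1, x => if 0 ≤ x ∧ x < 1 then 1 else 0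
  | (d + 2), x => ∫ y : ℝ, (if 0 ≤ x - y ∧ x - y < 1 then (1 : ℝ) else 0) * Bspline (d + 1) y

lemma abs_sinc_sq_le (t : ℝ) : (Real.sinc t) ^ 2 ≤ (1 + t ^ 2 / 4)⁻¹ := by
  by_cases h0 : t = 0
  · subst h0; simp
  rw [Real.sinc_of_ne_zero h0, div_pow]
  have ht : 0 < t ^ 2 := by positivity
  rw [div_le_iff₀ ht]
  rcases le_or_gt |t| π with h | h
  · obtain ⟨h1, h2⟩ := abs_le.mp h
    have hc : Real.cos (t / 2) ^ 2 ≤ (1 + t ^ 2 / 4)⁻¹ := by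
      have h3 := Real.cos_le_one_div_sqrt_sq_add_one (x := t / 2)
        (by linarith [Real.pi_pos]) (by linarith [Real.pi_pos])
      have h4 : 0 ≤ Real.cos (t / 2) :=
        Real.cos_nonneg_of_mem_Icc ⟨by linarith, by linarith⟩
      calc Real.cos (t / 2) ^ 2 ≤ (1 / √((t / 2) ^ 2 + 1)) ^ 2 := by gcongr
        _ = (1 + t ^ 2 / 4)⁻¹ := by
          rw [div_pow, Real.sq_sqrt (by positivity), one_pow, one_div]
          congr 1; ring
    have hs : Real.sin t = 2 * Real.sin (t / 2) * Real.cos (t / 2) := by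
      rw [← Real.sin_two_mul]; congr 1; ring
    have h5 : Real.sin (t / 2) ^ 2 ≤ (t / 2) ^ 2 :=
      sq_le_sq.mpr (Real.abs_sin_le_abs (x := t / 2))
    calc Real.sin t ^ 2 = 4 * Real.sin (t / 2) ^ 2 * Real.cos (t / 2) ^ 2 := by rw [hs]; ring
      _ ≤ 4 * (t / 2) ^ 2 * (1 + t ^ 2 / 4)⁻¹ := by gcongr
      _ = _ := by ring
  · have h3 : 3 < |t| := lt_trans Real.pi_gt_three h
    have h4 : 9 ≤ t ^ 2 := by rw [← sq_abs]; nlinarith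
    have h5 : Real.sin t ^ 2 ≤ 1 := Real.sin_sq_le_one t
    refine h5.trans ?_
    rw [inv_mul_eq_div, le_div_iff₀ (by positivity)]
    linarith

/-- Scaled Fourier transform of the B-spline. -/
noncomputable def psi (d : ℕ) (η : ℝ) : ℝ := Real.sinc (π * η / √((d : ℝ) / 12)) ^ d

lemma psi_bound (k d : ℕ) (hd : 2 * (k + 1) ≤ d) (η : ℝ) :
    |psi d η| ≤ ((k : ℝ) + 1) ^ (k + 1) * ((1 + η ^ 2)⁻¹) ^ (k + 1) := by
  have hd0 : (0 : ℝ) < d := by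
    have : 0 < d := by omega
    exact_mod_cast this
  have hdk : 2 * ((k : ℝ) + 1) ≤ d := by exact_mod_cast hd
  set m : ℝ := 2 * ((k : ℝ) + 1) with hm
  have hm0 : 0 < m := by positivity
  have h1 : (psi d η) ^ 2 ≤ ((1 + 3 * π ^ 2 * η ^ 2 / d)⁻¹) ^ d := by
    unfold psi
    rw [← pow_mul, mul_comm d 2, pow_mul]
    have := abs_sinc_sq_le (π * η / √((d : ℝ) / 12))
    rw [div_pow, Real.sq_sqrt (by positivity)] at this
    refine (pow_le_pow_left₀ (by positivity) this d).trans_eq ?_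
    congr 2; field_simp; ring
  have h2 : 1 + 3 * π ^ 2 * η ^ 2 / m ≤ (1 + 3 * π ^ 2 * η ^ 2 / d) ^ ((d : ℝ) / m) := by
    have := one_add_mul_self_le_rpow_one_add (s := 3 * π ^ 2 * η ^ 2 / d) (p := (d : ℝ) / m)
      (by have : 0 ≤ 3 * π ^ 2 * η ^ 2 / d := by positivity
          linarith) (by rw [le_div_iff₀ hm0]; linarith)
    refine le_trans (le_of_eq ?_) this
    field_simp
  have h3 : (1 + η ^ 2) / (k + 1) ≤ 1 + 3 * π ^ 2 * η ^ 2 / m := by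
    have hk : (0 : ℝ) ≤ k := by positivity
    have hpi : 9 ≤ π ^ 2 := by nlinarith [Real.pi_gt_three]
    rw [hm, div_le_iff₀ (by positivity)]
    have : (1 + 3 * π ^ 2 * η ^ 2 / (2 * ((k : ℝ) + 1))) * (k + 1)
      = (k + 1) + 3 * π ^ 2 * η ^ 2 / 2 := by field_simp
    rw [this]
    nlinarith [sq_nonneg η]
  have h4 : ((1 + η ^ 2) / (k + 1)) ^ (2 * (k + 1)) ≤ (1 + 3 * π ^ 2 * η ^ 2 / d) ^ d := by
    calc ((1 + η ^ 2) / (k + 1)) ^ (2 * (k + 1))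
        ≤ ((1 + 3 * π ^ 2 * η ^ 2 / d) ^ ((d : ℝ) / m)) ^ (2 * (k + 1)) := by
          gcongr; exact h3.trans h2
      _ = _ := by
          rw [← Real.rpow_natCast, ← Real.rpow_mul (by positivity), ← Real.rpow_natCast _ d]
          congr 1
          push_cast
          rw [← hm]; field_simp
  have h5 : (psi d η) ^ 2 ≤ (((k : ℝ) + 1) ^ (k + 1) * ((1 + η ^ 2)⁻¹) ^ (k + 1)) ^ 2 := by
    refine h1.trans ?_
    rw [inv_pow]
    refine (inv_anti₀ (by positivity) h4).trans_eq ?_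
    rw [← inv_pow, inv_div, ← mul_pow, ← pow_mul, mul_comm (k+1) 2, div_eq_mul_inv]
  exact abs_le_of_sq_le_sq h5 (by positivity)

lemma psi_continuous (d : ℕ) : Continuous (psi d) := by
  unfold psi
  exact (Real.continuous_sinc.comp (by fun_prop)).pow d

lemma psi_neg (d : ℕ) (η : ℝ) : psi d (-η) = psi d η := by
  unfold psi
  rw [mul_neg, neg_div, Real.sinc_neg]

lemma sinc_taylor : Tendsto (fun t : ℝ => (Real.sinc t - 1) / t ^ 2) (nhdsWithin 0 {0}ᶜ)
    (nhds (-(1/6))) := by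
  rw [tendsto_iff_norm_sub_tendsto_zero]
  have hlim : Tendsto (fun t : ℝ => |t| ^ 2 / 100) (nhdsWithin 0 {0}ᶜ) (nhds 0) := by
    have : Continuous (fun t : ℝ => |t| ^ 2 / 100) := by fun_prop
    have h := this.tendsto 0
    simp only [abs_zero, ne_eq, OfNat.ofNat_ne_zero, not_false_eq_true, zero_pow, zero_div] at h
    exact h.mono_left nhdsWithin_le_nhds
  refine squeeze_zero' (Eventually.of_forall fun _ => norm_nonneg _) ?_ hlim
  have h1 : ∀ᶠ t : ℝ in nhdsWithin 0 {0}ᶜ, |t| ≤ 1 := by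
    have : Metric.ball (0 : ℝ) 1 ∈ nhdsWithin (0 : ℝ) {0}ᶜ :=
      nhdsWithin_le_nhds (Metric.ball_mem_nhds _ one_pos)
    filter_upwards [this] with t ht
    simpa using (le_of_lt (by simpa using ht : |t| < 1))
  filter_upwards [h1, self_mem_nhdsWithin] with t ht h0
  have h0' : t ≠ 0 := h0
  rw [Real.sinc_of_ne_zero h0', Real.norm_eq_abs]
  have := Real.sin_bound ht
  have e : (Real.sin t / t - 1) / t ^ 2 - -(1/6) = (Real.sin t - (t - t ^ 3 / 6)) / t ^ 3 := by
    field_simp; ring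
  rw [e, abs_div, abs_pow, div_le_iff₀ (by positivity)]
  linarith [this, show |t| ^ 2 / 100 * |t| ^ 3 = |t| ^ 5 / 100 by ring]

lemma psi_tendsto (η : ℝ) :
    Tendsto (fun d : ℕ => psi d η) atTop (nhds (Real.exp (-2 * π ^ 2 * η ^ 2))) := by
  have key : Tendsto (fun d : ℕ => (d : ℝ) * (Real.sinc (π * η / √((d : ℝ) / 12)) - 1)) atTop
      (nhds (-2 * π ^ 2 * η ^ 2)) := by
    by_cases h0 : η = 0
    · subst h0; simp
    have ht : Tendsto (fun d : ℕ => π * η / √((d : ℝ) / 12)) atTop (nhdsWithin 0 {0}ᶜ) := by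
      refine tendsto_nhdsWithin_iff.mpr ⟨?_, ?_⟩
      · refine Tendsto.div_atTop tendsto_const_nhds ?_
        exact Real.tendsto_sqrt_atTop.comp
          (tendsto_natCast_atTop_atTop.atTop_div_const (by norm_num))
      · filter_upwards [eventually_gt_atTop 0] with d hd
        have : (0 : ℝ) < d := by exact_mod_cast hd
        have h2 : √((d : ℝ) / 12) ≠ 0 := by positivity
        simp [h0, Real.pi_ne_zero, this.ne']
    have h := (sinc_taylor.comp ht).const_mul (12 * π ^ 2 * η ^ 2)
    have e : 12 * π ^ 2 * η ^ 2 * -(1/6) = -2 * π ^ 2 * η ^ 2 := by ring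
    rw [e] at h
    refine h.congr' ?_
    filter_upwards [eventually_gt_atTop 0] with d hd
    have : (0 : ℝ) < d := by exact_mod_cast hd
    simp only [Function.comp]
    rw [div_pow (π * η), Real.sq_sqrt (by positivity)]
    field_simp [Real.pi_ne_zero]
  have := Real.tendsto_one_add_pow_exp_of_tendsto key
  refine this.congr fun d => ?_
  unfold psi
  congr 1; ring

lemma gamma_bound (k : ℕ) (η : ℝ) :
    |Real.exp (-2 * π ^ 2 * η ^ 2)| ≤ ((k : ℝ) + 1) ^ (k + 1) * ((1 + η ^ 2)⁻¹) ^ (k + 1) := by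
  refine le_of_tendsto (psi_tendsto η).abs ?_
  filter_upwards [eventually_ge_atTop (2 * (k + 1))] with d hd using psi_bound k d hd η

open scoped FourierTransform Convolution

lemma Bspline_one_eq : Bspline 1 = Set.indicator (Set.Ico 0 1) (fun _ => (1 : ℝ)) := by
  funext x
  simp [Bspline, Set.indicator_apply, Set.mem_Ico]

lemma Bspline_succ_eq_interval (d : ℕ) (x : ℝ) :
    Bspline (d + 2) x = ∫ y in (x - 1)..x, Bspline (d + 1) y := by
  rw [intervalIntegral.integral_of_le (by linarith), ← integral_indicator measurableSet_Ioc]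
  rw [Bspline]
  refine integral_congr_ae (Eventually.of_forall fun y => ?_)
  simp only [Set.indicator_apply, Set.mem_Ioc]
  by_cases h : x - 1 < y ∧ y ≤ x
  · rw [if_pos h, if_pos ⟨by linarith, by linarith⟩, one_mul]
  · rw [if_neg h, if_neg (fun h' => h ⟨by linarith [h'.2], by linarith [h'.1]⟩), zero_mul]

lemma Bc_succ_eq_conv (d : ℕ) : (fun x => (Bspline (d + 2) x : ℂ)) =
    (fun x => (Bspline (d + 1) x : ℂ)) ⋆[ContinuousLinearMap.mul ℂ ℂ]
      (fun x => (Bspline 1 x : ℂ)) := by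
  funext x
  rw [convolution_def, Bspline, ← integral_complex_ofReal]
  refine integral_congr_ae (Eventually.of_forall fun y => ?_)
  simp only [ContinuousLinearMap.mul_apply', Bspline]
  push_cast
  ring

lemma Bc_integrable (d : ℕ) : Integrable (fun x => (Bspline (d + 1) x : ℂ)) := by
  have h1 : Integrable (fun x => (Bspline 1 x : ℂ)) := by
    have h0 : Integrable (Bspline 1) := by
      rw [Bspline_one_eq, integrable_indicator_iff measurableSet_Ico]
      simp
    exact h0.ofReal
  induction d with
  | zero => exact h1
  | succ d ih =>
    rw [Bc_succ_eq_conv d]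
    exact ih.integrable_convolution _ h1

lemma Bspline_integrable (d : ℕ) : Integrable (Bspline (d + 1)) := by
  simpa using (Bc_integrable d).re

lemma Bspline_continuous (d : ℕ) : Continuous (Bspline (d + 2)) := by
  have hi : ∀ a b, IntervalIntegrable (Bspline (d + 1)) volume a b :=
    fun a b => (Bspline_integrable d).intervalIntegrable
  have hc := intervalIntegral.continuous_primitive hi 0
  have : Bspline (d + 2) = fun x => (∫ y in (0:ℝ)..x, Bspline (d + 1) y) -
      ∫ y in (0:ℝ)..(x - 1), Bspline (d + 1) y := by
    funext x
    rw [Bspline_succ_eq_interval, intervalIntegral.integral_interval_sub_left (hi _ _) (hi _ _)]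
  rw [this]
  exact hc.sub (hc.comp (by fun_prop))

lemma Bspline_eq_zero (d : ℕ) (x : ℝ) (hx : x < 0 ∨ (d : ℝ) + 1 < x) : Bspline (d + 1) x = 0 := by
  induction d generalizing x with
  | zero =>
    simp only [Bspline]
    rw [if_neg]
    rintro ⟨h1, h2⟩
    rcases hx with h | h
    · linarith
    · push_cast at h; linarith
  | succ d ih =>
    rw [Bspline_succ_eq_interval, intervalIntegral.integral_of_le (by linarith)]
    refine setIntegral_eq_zero_of_forall_eq_zero fun y hy => ih y ?_
    push_cast at hx
    rcases hx with h | h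
    · left; linarith [hy.2]
    · right; linarith [hy.1]

lemma Bspline_hasCompactSupport (d : ℕ) : HasCompactSupport (Bspline (d + 1)) := by
  refine HasCompactSupport.of_support_subset_isCompact (isCompact_Icc (a := (0:ℝ)) (b := d + 1)) ?_
  intro x hx
  by_contra h
  apply hx
  apply Bspline_eq_zero
  rw [Set.mem_Icc, not_and_or, not_le, not_le] at h
  exact h

lemma fourier_Bc_one (ξ : ℝ) : 𝓕 (fun x => (Bspline 1 x : ℂ)) ξ =
    Complex.exp (-(π * ξ) * Complex.I) * (Real.sinc (π * ξ) : ℂ) := by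
  rw [Real.fourier_real_eq_integral_exp_smul]
  have h1 : ∫ v : ℝ, Complex.exp (↑(-2 * π * v * ξ) * Complex.I) • (Bspline 1 v : ℂ) =
      ∫ v in (0:ℝ)..1, Complex.exp ((-2 * π * ξ * Complex.I) * v) := by
    rw [intervalIntegral.integral_of_le zero_le_one, ← integral_Ico_eq_integral_Ioc,
      ← integral_indicator measurableSet_Ico]
    refine integral_congr_ae (Eventually.of_forall fun y => ?_)
    simp only [Bspline_one_eq, Set.indicator_apply]
    split_ifs
    · simp only [smul_eq_mul, Complex.ofReal_one, mul_one]
      congr 1; push_cast; ring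
    · simp
  rw [h1]
  by_cases h0 : ξ = 0
  · subst h0; simp
  have hpi : (π : ℂ) ≠ 0 := by exact_mod_cast Real.pi_ne_zero
  have h0' : (ξ : ℂ) ≠ 0 := by exact_mod_cast h0
  have hne : (-2 * π * ξ * Complex.I : ℂ) ≠ 0 := by simp [hpi, h0']
  rw [integral_exp_mul_complex hne, Real.sinc_of_ne_zero (by positivity)]
  push_cast
  rw [Complex.sin]
  have e1 : Complex.exp (-2 * π * ξ * Complex.I * 1) =
      Complex.exp (-(π * ξ) * Complex.I) * Complex.exp (-(π * ξ) * Complex.I) := by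
    rw [← Complex.exp_add]; congr 1; ring
  have e2 : Complex.exp (-(π * ξ) * Complex.I) * Complex.exp (π * ξ * Complex.I) = 1 := by
    rw [← Complex.exp_add, ← Complex.exp_zero]; congr 1; ring
  rw [e1]
  simp only [mul_zero, Complex.exp_zero]
  field_simp
  simp only [Complex.I_sq, ← neg_mul] at *
  linear_combination (-1) * e2

lemma fourier_Bc (d : ℕ) (ξ : ℝ) : 𝓕 (fun x => (Bspline (d + 1) x : ℂ)) ξ =
    (Complex.exp (-(π * ξ) * Complex.I) * (Real.sinc (π * ξ) : ℂ)) ^ (d + 1) := by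
  induction d with
  | zero => simpa using fourier_Bc_one ξ
  | succ d ih =>
    rw [Bc_succ_eq_conv d, Real.fourier_mul_convolution_eq (Bc_integrable d) (Bc_integrable 0), ih]
    rw [fourier_Bc_one]; ring

/-- The rescaled centred B-spline. -/
noncomputable def uB (d : ℕ) (x : ℝ) : ℝ :=
  √((d : ℝ) / 12) * Bspline d (√((d : ℝ) / 12) * x + (d : ℝ) / 2)

lemma uB_integrable (d : ℕ) (hd : 1 ≤ d) : Integrable (uB d) := by
  have hd0 : (0 : ℝ) < d := by exact_mod_cast hd
  obtain ⟨e, rfl⟩ : ∃ e, d = e + 1 := ⟨d - 1, by omega⟩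
  unfold uB
  refine Integrable.const_mul ?_ _
  exact ((Bspline_integrable e).comp_add_right _).comp_mul_left' (by positivity)

lemma uB_continuous (d : ℕ) (hd : 2 ≤ d) : Continuous (uB d) := by
  obtain ⟨e, rfl⟩ : ∃ e, d = e + 2 := ⟨d - 2, by omega⟩
  unfold uB
  exact continuous_const.mul ((Bspline_continuous e).comp (by fun_prop))

lemma uB_hasCompactSupport (d : ℕ) (hd : 1 ≤ d) : HasCompactSupport (uB d) := by
  have hd0 : (0 : ℝ) < d := by exact_mod_cast hd
  have hs : 0 < √((d : ℝ) / 12) := by positivity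
  obtain ⟨e, rfl⟩ : ∃ e, d = e + 1 := ⟨d - 1, by omega⟩
  have h1 := (Bspline_hasCompactSupport e).comp_homeomorph
    ((Homeomorph.mulLeft₀ _ hs.ne').trans (Homeomorph.addRight (((e + 1 : ℕ) : ℝ) / 2)))
  exact h1.mul_left (f := fun _ => √(((e + 1 : ℕ) : ℝ) / 12))

lemma fourier_uB (d : ℕ) (hd : 1 ≤ d) :
    𝓕 (fun x => (uB d x : ℂ)) = fun η => (psi d η : ℂ) := by
  funext η
  have hd0 : (0 : ℝ) < d := by exact_mod_cast hd
  obtain ⟨e, he⟩ : ∃ e, d = e + 1 := ⟨d - 1, by omega⟩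
  set s := √((d : ℝ) / 12) with hs_def
  have hs : 0 < s := by positivity
  have hF := fourier_Bc e (η / s)
  rw [← he] at hF
  rw [Real.fourier_real_eq_integral_exp_smul] at hF ⊢
  -- change variables
  have h1 : ∀ G : ℝ → ℂ, ∫ x : ℝ, (s : ℂ) * G (s * x + (d : ℝ) / 2) = ∫ y, G y := by
    intro G
    rw [MeasureTheory.integral_const_mul]
    have := Measure.integral_comp_mul_left (fun y => G (y + (d : ℝ) / 2)) s
    rw [this, integral_add_right_eq_self (fun y => G y) ((d : ℝ) / 2), abs_of_pos (inv_pos.mpr hs)]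
    rw [Complex.real_smul, ← mul_assoc, Complex.ofReal_inv, mul_inv_cancel₀, one_mul]
    exact_mod_cast hs.ne'
  have hsc : (s : ℂ) ≠ 0 := by exact_mod_cast hs.ne'
  have h2 := h1 (fun y => Complex.exp (π * d * (η / s) * Complex.I) *
    (Complex.exp (↑(-2 * π * y * (η / s)) * Complex.I) • (Bspline d y : ℂ)))
  rw [MeasureTheory.integral_const_mul (Complex.exp (π * d * (η / s) * Complex.I))
    (fun y : ℝ => Complex.exp (↑(-2 * π * y * (η / s)) * Complex.I) • (Bspline d y : ℂ)),
    hF, mul_pow, ← mul_assoc, ← Complex.exp_nat_mul,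
    ← Complex.exp_add] at h2
  have e0 : (π * d * (η / s) * Complex.I +
      (d : ℂ) * (-(π * ((η / s : ℝ) : ℂ)) * Complex.I) : ℂ) = 0 := by
    push_cast; ring
  rw [e0, Complex.exp_zero, one_mul] at h2
  have e3 : ((psi d η : ℝ) : ℂ) = ((Real.sinc (π * (η / s)) : ℝ) : ℂ) ^ d := by
    unfold psi
    rw [← hs_def, mul_div_assoc]; push_cast; rfl
  rw [e3, ← h2]
  refine integral_congr_ae (Eventually.of_forall fun x => ?_)
  simp only [uB, ← hs_def, smul_eq_mul]
  rw [← mul_assoc (Complex.exp _) (Complex.exp _), ← Complex.exp_add]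
  have e4 : (π * d * (η / s) * Complex.I +
      ↑(-2 * π * (s * x + (d : ℝ) / 2) * (η / s)) * Complex.I : ℂ)
      = ↑(-2 * π * x * η) * Complex.I := by
    push_cast; field_simp; ring
  rw [e4]
  push_cast
  ring

lemma wt_integrable (k n : ℕ) (hn : n ≤ k) (C : ℝ) (φ : ℝ → ℝ) (hφ : Continuous φ)
    (hb : ∀ η, |φ η| ≤ C * ((1 + η ^ 2)⁻¹) ^ (k + 1)) :
    Integrable (fun η : ℝ => η ^ n • (φ η : ℂ)) := by
  refine Integrable.mono' (integrable_inv_one_add_sq.const_mul C) ?_ ?_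
  · exact Continuous.aestronglyMeasurable (by fun_prop)
  · refine Eventually.of_forall fun η => ?_
    have h1 : |η| ^ n ≤ (1 + η ^ 2) ^ k := by
      calc |η| ^ n ≤ (1 + η ^ 2) ^ n := by
            gcongr
            rw [← sq_abs]
            nlinarith [sq_nonneg (|η| - 1), abs_nonneg η]
        _ ≤ (1 + η ^ 2) ^ k := pow_le_pow_right₀ (by nlinarith [sq_nonneg η]) hn
    rw [norm_smul, norm_pow, Real.norm_eq_abs, Complex.norm_real, Real.norm_eq_abs]
    calc |η| ^ n * |φ η| ≤ (1 + η ^ 2) ^ k * (C * ((1 + η ^ 2)⁻¹) ^ (k + 1)) :=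
          mul_le_mul h1 (hb η) (abs_nonneg _) (by positivity)
      _ = C * (1 + η ^ 2)⁻¹ := by
          have : (1 + η ^ 2) ≠ 0 := by positivity
          rw [inv_pow]; field_simp; ring

/-- Fourier multiplier of the `k`-th derivative. -/
noncomputable def wt (k : ℕ) (φ : ℝ → ℝ) (η : ℝ) : ℂ := (-2 * π * Complex.I * η) ^ k • (φ η : ℂ)

lemma wt_norm (k : ℕ) (φ : ℝ → ℝ) (η : ℝ) : ‖wt k φ η‖ = (2 * π) ^ k * (|η| ^ k * |φ η|) := by
  unfold wt
  rw [norm_smul, norm_pow, Complex.norm_real]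
  simp [mul_pow, abs_of_pos Real.pi_pos, mul_assoc]

lemma wt_bound (k : ℕ) (C : ℝ) (φ : ℝ → ℝ)
    (hb : ∀ η, |φ η| ≤ C * ((1 + η ^ 2)⁻¹) ^ (k + 1)) (η : ℝ) :
    ‖wt k φ η‖ ≤ (2 * π) ^ k * C * (1 + η ^ 2)⁻¹ := by
  rw [wt_norm, mul_assoc]
  refine mul_le_mul_of_nonneg_left ?_ (by positivity)
  have h1 : |η| ^ k ≤ (1 + η ^ 2) ^ k := by
    gcongr
    rw [← sq_abs]
    nlinarith [sq_nonneg (|η| - 1), abs_nonneg η]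
  calc |η| ^ k * |φ η| ≤ (1 + η ^ 2) ^ k * (C * ((1 + η ^ 2)⁻¹) ^ (k + 1)) :=
        mul_le_mul h1 (hb η) (abs_nonneg _) (by positivity)
    _ = C * (1 + η ^ 2)⁻¹ := by
        have : (1 + η ^ 2) ≠ 0 := by positivity
        rw [inv_pow]; field_simp; ring

lemma wt_continuous (k : ℕ) (φ : ℝ → ℝ) (hφ : Continuous φ) : Continuous (wt k φ) := by
  unfold wt; fun_prop

lemma wt_integrable' (k : ℕ) (C : ℝ) (φ : ℝ → ℝ) (hφ : Continuous φ)
    (hb : ∀ η, |φ η| ≤ C * ((1 + η ^ 2)⁻¹) ^ (k + 1)) : Integrable (wt k φ) := by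
  refine Integrable.mono' (integrable_inv_one_add_sq.const_mul ((2 * π) ^ k * C))
    (wt_continuous k φ hφ).aestronglyMeasurable (Eventually.of_forall (wt_bound k C φ hb))

lemma deriv_repr (k : ℕ) (C : ℝ) (φ u : ℝ → ℝ) (hφ : Continuous φ)
    (hb : ∀ η, |φ η| ≤ C * ((1 + η ^ 2)⁻¹) ^ (k + 1))
    (hu : (fun x => (u x : ℂ)) = 𝓕 (fun η => (φ η : ℂ))) :
    ContDiff ℝ k u ∧ ∀ x, ((iteratedDeriv k u x : ℝ) : ℂ) = 𝓕 (wt k φ) x := by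
  have hint : ∀ n : ℕ, (n : ℕ∞) ≤ (k : ℕ∞) → Integrable (fun η : ℝ => η ^ n • (φ η : ℂ)) :=
    fun n hn => wt_integrable k n (by exact_mod_cast hn) C φ hφ hb
  have hcd : ContDiff ℝ k (𝓕 (fun η => (φ η : ℂ))) := by
    have := Real.contDiff_fourier (f := fun η : ℝ => (φ η : ℂ)) (N := (k : ℕ∞)) (fun n hn => by
      have := (hint n hn).norm
      simpa [norm_smul] using this)
    exact_mod_cast this
  have hcu : ContDiff ℝ k u := by
    rw [← hu] at hcd
    have h := Complex.reCLM.contDiff.comp hcd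
    have e : (Complex.reCLM ∘ fun x => (u x : ℂ)) = u := by funext x; simp
    rw [← e]
    exact h.of_le le_rfl
  refine ⟨hcu, fun x => ?_⟩
  have h1 := Real.iteratedDeriv_fourier hint le_rfl
  rw [← hu] at h1
  have h2 : iteratedDeriv k (fun x => (u x : ℂ)) x = ((iteratedDeriv k u x : ℝ) : ℂ) := by
    have := Complex.ofRealCLM.iteratedFDeriv_comp_left (hcu.contDiffAt (x := x)) (i := k) le_rfl
    rw [iteratedDeriv, iteratedDeriv]
    have e : (Complex.ofRealCLM ∘ u) = fun x => (u x : ℂ) := by funext x; simp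
    rw [e] at this
    rw [this]
    simp
  rw [← h2, h1]
  rfl

lemma uB_repr (d : ℕ) (hd : 2 ≤ d) :
    (fun x => (uB d x : ℂ)) = 𝓕 (fun η => (psi d η : ℂ)) := by
  have hc : Continuous (fun x => (uB d x : ℂ)) :=
    Complex.continuous_ofReal.comp (uB_continuous d hd)
  have hF := fourier_uB d (by omega)
  have hi : Integrable (fun η => (psi d η : ℂ)) := by
    simpa using wt_integrable 0 0 le_rfl _ (psi d) (psi_continuous d)
      (fun η => psi_bound 0 d (by omega) η)
  have h := hc.fourierInv_fourier_eq (uB_integrable d (by omega)).ofReal (by rw [hF]; exact hi)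
  rw [hF] at h
  rw [← h, Real.fourierInv_eq_fourier_comp_neg]
  simp only [psi_neg]

/-- The Gaussian density. -/
noncomputable def gs (x : ℝ) : ℝ := (1 / √(2 * π)) * Real.exp (-(x ^ 2) / 2)

/-- The Fourier transform of the Gaussian density. -/
noncomputable def gam (η : ℝ) : ℝ := Real.exp (-2 * π ^ 2 * η ^ 2)

lemma gam_continuous : Continuous gam := by unfold gam; fun_prop

lemma gs_repr : (fun x => (gs x : ℂ)) = 𝓕 (fun η => (gam η : ℂ)) := by
  have h := fourier_gaussian_pi (b := ((2 * π : ℝ) : ℂ))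
    (by rw [Complex.ofReal_re]; positivity)
  have e : (fun η => (gam η : ℂ)) =
      fun x : ℝ => Complex.exp (-π * ((2 * π : ℝ) : ℂ) * x ^ 2) := by
    funext η
    unfold gam
    push_cast
    congr 1; ring
  rw [e, h]
  funext x
  unfold gs
  have hs : ((2 * π : ℝ) : ℂ) ^ (1 / 2 : ℂ) = ((√(2 * π) : ℝ) : ℂ) := by
    rw [Real.sqrt_eq_rpow, Complex.ofReal_cpow (by positivity)]
    norm_num
  rw [hs]
  have hpi : (π : ℂ) ≠ 0 := by exact_mod_cast Real.pi_ne_zero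
  rw [Complex.ofReal_mul, Complex.ofReal_exp]
  congr 1
  · simp
  · congr 1; push_cast; field_simp

lemma poly_gauss_integrable (P : Polynomial ℝ) :
    Integrable (fun x : ℝ => P.eval x * Real.exp (-(x ^ 2 / 2))) := by
  induction P using Polynomial.induction_on' with
  | add p q hp hq => simp only [Polynomial.eval_add, add_mul]; exact hp.add hq
  | monomial n a =>
    have h := integrable_rpow_mul_exp_neg_mul_sq (b := 1/2) (by norm_num) (s := (n : ℝ))
      (by have : (0:ℝ) ≤ n := by positivity
          linarith)
    refine (h.const_mul a).congr (Eventually.of_forall fun x => ?_)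
    simp only [Polynomial.eval_monomial, Real.rpow_natCast]
    rw [mul_assoc]; congr 3; ring

lemma gs_deriv_integrable (k : ℕ) : Integrable (iteratedDeriv k gs) := by
  have h : iteratedDeriv k gs = fun x => (1 / √(2 * π)) * ((-1) ^ k *
      (((Polynomial.hermite k).map (Int.castRingHom ℝ)).eval x * Real.exp (-(x ^ 2 / 2)))) := by
    funext x
    have e : gs = fun x => (1 / √(2 * π)) * (fun y : ℝ => Real.exp (-(y ^ 2 / 2))) x := by
      funext y; unfold gs; rw [neg_div]
    rw [e, iteratedDeriv_const_mul_field, iteratedDeriv_eq_iterate,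
      Polynomial.deriv_gaussian_eq_hermite_mul_gaussian, Polynomial.eval_map, Polynomial.aeval_def]
    rw [mul_assoc]; rfl
  rw [h]
  exact ((poly_gauss_integrable _).const_mul _).const_mul _

lemma uB_deriv_integrable (k d : ℕ) (hd : 1 ≤ d) (h : ContDiff ℝ k (uB d)) :
    Integrable (iteratedDeriv k (uB d)) := by
  refine Continuous.integrable_of_hasCompactSupport
    (h.continuous_iteratedDeriv k le_rfl) ?_
  rw [iteratedDeriv_eq_iterate]
  have : ∀ j, HasCompactSupport (deriv^[j] (uB d)) := by
    intro j
    induction j with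
    | zero => exact uB_hasCompactSupport d hd
    | succ j ih => rw [Function.iterate_succ_apply']; exact ih.deriv
  exact this k

lemma plancherel_of (W : ℝ → ℂ) (hc : Continuous W) (hi : Integrable W) (hF : Integrable (𝓕 W)) :
    ∫ x, ‖𝓕 W x‖ ^ 2 = ∫ η, ‖W η‖ ^ 2 := by
  have h := VectorFourier.integral_sesq_fourierIntegral_eq_neg_flip (innerSL ℂ (E := ℂ))
    (L := innerₗ ℝ) Real.continuous_fourierChar (μ := volume) (ν := volume)
    continuous_inner hi hF
  have hinv := hc.fourierInv_fourier_eq hi hF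
  have e1 : (VectorFourier.fourierIntegral Real.fourierChar volume (-(innerₗ ℝ).flip) (𝓕 W)) = W := by
    conv_rhs => rw [← hinv]
    rw [flip_innerₗ]
    rfl
  rw [e1] at h
  change ∫ x, inner ℂ (𝓕 W x) (𝓕 W x) = ∫ x, inner ℂ (W x) (W x) at h
  simp only [inner_self_eq_norm_sq_to_K] at h
  have h3 : ((∫ x, ‖𝓕 W x‖ ^ 2 : ℝ) : ℂ) = ((∫ η, ‖W η‖ ^ 2 : ℝ) : ℂ) := by
    rw [← integral_complex_ofReal, ← integral_complex_ofReal]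
    simpa using h
  exact_mod_cast h3

lemma uB_deriv (k d : ℕ) (hd : 1 ≤ d) (h : ContDiff ℝ k (uB d)) (x : ℝ) :
    iteratedDeriv k (uB d) x = ((d : ℝ) / 12) ^ (((k : ℝ) + 1) / 2) *
      iteratedDeriv k (Bspline d) (√((d : ℝ) / 12) * x + (d : ℝ) / 2) := by
  have hd0 : (0 : ℝ) < d := by exact_mod_cast hd
  set s := √((d : ℝ) / 12) with hs_def
  have hs : 0 < s := by positivity
  have hB : ContDiff ℝ k (fun y => Bspline d (y + (d : ℝ) / 2)) := by
    have e : (fun y => Bspline d (y + (d : ℝ) / 2)) = fun y => s⁻¹ * uB d (s⁻¹ * y) := by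
      funext y
      simp only [uB, ← hs_def]
      rw [← mul_assoc, inv_mul_cancel₀ hs.ne', one_mul, ← mul_assoc, mul_inv_cancel₀ hs.ne', one_mul]
    rw [e]
    exact contDiff_const.mul (h.comp (by fun_prop))
  have e : uB d = fun x => s * (fun z => (fun y => Bspline d (y + (d : ℝ) / 2)) (s * z)) x := by
    funext x; simp only [uB, ← hs_def]
  rw [e, iteratedDeriv_const_mul_field, iteratedDeriv_comp_const_mul hB]
  rw [iteratedDeriv_comp_add_const]
  have hpow : ((d : ℝ) / 12) ^ (((k : ℝ) + 1) / 2) = s * s ^ k := by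
    rw [← pow_succ', hs_def, Real.sqrt_eq_rpow, ← Real.rpow_natCast, ← Real.rpow_mul (by positivity)]
    congr 1; push_cast; ring
  rw [hpow]; ring

/-- Bound constant. -/
noncomputable def Ck (k : ℕ) : ℝ := ((k : ℝ) + 1) ^ (k + 1)

lemma diff_bound (k d : ℕ) (hd : 2 * (k + 1) ≤ d) (η : ℝ) :
    |psi d η - gam η| ≤ (2 * Ck k) * ((1 + η ^ 2)⁻¹) ^ (k + 1) := by
  have h1 := psi_bound k d hd η
  have h2 := gamma_bound k η
  have h3 := abs_sub (psi d η) (gam η)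
  unfold Ck
  unfold gam at *
  linarith

lemma wt_diff_tendsto (k : ℕ) (η : ℝ) :
    Tendsto (fun d : ℕ => ‖wt k (fun η => psi d η - gam η) η‖) atTop (nhds 0) := by
  simp only [wt_norm]
  have h : Tendsto (fun d : ℕ => psi d η - gam η) atTop (nhds (gam η - gam η)) :=
    (psi_tendsto η).sub_const _
  have h2 := (h.abs.const_mul (|η| ^ k)).const_mul ((2 * π) ^ k)
  simpa using h2

lemma S_tendsto (k : ℕ) :
    Tendsto (fun d : ℕ => ∫ η, ‖wt k (fun η => psi d η - gam η) η‖) atTop (nhds 0) := by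
  have h := tendsto_integral_filter_of_dominated_convergence (μ := volume) (l := atTop)
    (F := fun (d : ℕ) η => ‖wt k (fun η => psi d η - gam η) η‖) (f := fun _ => (0 : ℝ))
    (fun η => (2 * π) ^ k * (2 * Ck k) * (1 + η ^ 2)⁻¹)
    (Eventually.of_forall fun d => (wt_continuous k _
      ((psi_continuous d).sub gam_continuous)).norm.aestronglyMeasurable)
    (by
      filter_upwards [eventually_ge_atTop (2 * (k + 1))] with d hd
      refine Eventually.of_forall fun η => ?_
      rw [norm_norm]
      exact wt_bound k _ _ (diff_bound k d hd) η)
    (integrable_inv_one_add_sq.const_mul _)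
    (Eventually.of_forall fun η => wt_diff_tendsto k η)
  simpa using h

lemma Q_tendsto (k : ℕ) :
    Tendsto (fun d : ℕ => ∫ η, ‖wt k (fun η => psi d η - gam η) η‖ ^ 2) atTop (nhds 0) := by
  have h := tendsto_integral_filter_of_dominated_convergence (μ := volume) (l := atTop)
    (F := fun (d : ℕ) η => ‖wt k (fun η => psi d η - gam η) η‖ ^ 2) (f := fun _ => (0 : ℝ))
    (fun η => ((2 * π) ^ k * (2 * Ck k)) ^ 2 * (1 + η ^ 2)⁻¹)
    (Eventually.of_forall fun d => ((wt_continuous k _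
      ((psi_continuous d).sub gam_continuous)).norm.pow 2).aestronglyMeasurable)
    (by
      filter_upwards [eventually_ge_atTop (2 * (k + 1))] with d hd
      refine Eventually.of_forall fun η => ?_
      have h1 := wt_bound k _ _ (diff_bound k d hd) η
      rw [norm_pow, norm_norm]
      calc _ ≤ ((2 * π) ^ k * (2 * Ck k) * (1 + η ^ 2)⁻¹) ^ 2 :=
            pow_le_pow_left₀ (norm_nonneg _) h1 2
        _ = ((2 * π) ^ k * (2 * Ck k)) ^ 2 * ((1 + η ^ 2)⁻¹) ^ 2 := by ring
        _ ≤ _ := by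
          refine mul_le_mul_of_nonneg_left ?_ (by positivity)
          exact pow_le_of_le_one (by positivity)
            (inv_le_one_of_one_le₀ (by nlinarith [sq_nonneg η])) two_ne_zero)
    (integrable_inv_one_add_sq.const_mul _)
    (Eventually.of_forall fun η => by simpa using (wt_diff_tendsto k η).pow 2)
  simpa using h

lemma main_estimate (k d : ℕ) (hd : 2 * (k + 1) ≤ d) (p : ℝ) (hp : 2 ≤ p)
    (hS : ∫ η, ‖wt k (fun η => psi d η - gam η) η‖ ≤ 1) :
    ∫ x, |iteratedDeriv k (uB d) x - iteratedDeriv k gs x| ^ p ≤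
      ∫ η, ‖wt k (fun η => psi d η - gam η) η‖ ^ 2 := by
  set W := wt k (fun η => psi d η - gam η) with hW
  obtain ⟨hu1, hu2⟩ := deriv_repr k (Ck k) (psi d) (uB d) (psi_continuous d)
    (psi_bound k d hd) (uB_repr d (by omega))
  obtain ⟨hg1, hg2⟩ := deriv_repr k (Ck k) gam gs gam_continuous (gamma_bound k) gs_repr
  have hi1 : Integrable (wt k (psi d)) :=
    wt_integrable' k (Ck k) _ (psi_continuous d) (psi_bound k d hd)
  have hi2 : Integrable (wt k gam) :=
    wt_integrable' k (Ck k) _ gam_continuous (gamma_bound k)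
  have hWe : W = fun η => wt k (psi d) η - wt k gam η := by
    funext η
    simp only [hW, wt]
    push_cast
    rw [smul_sub]
  have hiW : Integrable W := by rw [hWe]; exact hi1.sub hi2
  have hcW : Continuous W := wt_continuous k _ ((psi_continuous d).sub gam_continuous)
  have hFW : ∀ x, 𝓕 W x =
      ((iteratedDeriv k (uB d) x - iteratedDeriv k gs x : ℝ) : ℂ) := by
    intro x
    rw [Complex.ofReal_sub, hu2, hg2, hWe]
    simp only [Real.fourier_eq, smul_sub]
    exact integral_sub ((Real.fourierIntegral_convergent_iff x).2 hi1)
      ((Real.fourierIntegral_convergent_iff x).2 hi2)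
  have hF : Integrable (fun x => iteratedDeriv k (uB d) x - iteratedDeriv k gs x) :=
    (uB_deriv_integrable k d (by omega) hu1).sub (gs_deriv_integrable k)
  have hFi : Integrable (𝓕 W) := by
    have : 𝓕 W = fun x => ((iteratedDeriv k (uB d) x - iteratedDeriv k gs x : ℝ) : ℂ) :=
      funext hFW
    rw [this]
    exact hF.ofReal
  have hle : ∀ x, |iteratedDeriv k (uB d) x - iteratedDeriv k gs x| ≤ 1 := by
    intro x
    have h1 : ‖𝓕 W x‖ ≤ ∫ η, ‖W η‖ :=
      VectorFourier.norm_fourierIntegral_le_integral_norm _ _ _ _ _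
    rw [hFW, Complex.norm_real, Real.norm_eq_abs] at h1
    exact h1.trans hS
  rw [← plancherel_of W hcW hiW hFi]
  refine integral_mono_of_nonneg (Eventually.of_forall fun x => by positivity) ?_
    (Eventually.of_forall fun x => ?_)
  · refine Integrable.mono' hF.abs (hFi.aestronglyMeasurable.norm.pow 2)
      (Eventually.of_forall fun x => ?_)
    rw [hFW, Complex.norm_real, norm_pow, norm_norm, Real.norm_eq_abs]
    exact pow_le_of_le_one (abs_nonneg _) (hle x) two_ne_zero
  · simp only [hFW, Complex.norm_real, Real.norm_eq_abs]
    rw [← Real.rpow_natCast]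
    by_cases h0 : |iteratedDeriv k (uB d) x - iteratedDeriv k gs x| = 0
    · rw [h0, Real.zero_rpow (by linarith), Real.zero_rpow (by norm_num)]
    · exact Real.rpow_le_rpow_of_exponent_ge (lt_of_le_of_ne (abs_nonneg _) (Ne.symm h0))
        (hle x) (by push_cast; exact hp)


theorem bspline_deriv_gaussian_Lp_limit (k : ℕ) (p : ℝ) (hp : 2 ≤ p) :
    Tendsto (fun d : ℕ => ∫ x : ℝ,
        |((d : ℝ) / 12) ^ (((k : ℝ) + 1) / 2) *
            iteratedDeriv k (Bspline d) (Real.sqrt ((d : ℝ) / 12) * x + (d : ℝ) / 2) -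
          (1 / Real.sqrt (2 * π)) *
            iteratedDeriv k (fun t : ℝ => Real.exp (-(t ^ 2) / 2)) x| ^ p)
      atTop (nhds 0) := by
  have hS := (S_tendsto k).eventually (ge_mem_nhds (zero_lt_one (α := ℝ)))
  refine squeeze_zero' (Eventually.of_forall fun d => integral_nonneg fun x => by positivity) ?_
    (Q_tendsto k)
  filter_upwards [hS, eventually_ge_atTop (2 * (k + 1))] with d h1 hd
  obtain ⟨hu1, -⟩ := deriv_repr k (Ck k) (psi d) (uB d) (psi_continuous d)
    (psi_bound k d hd) (uB_repr d (by omega))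
  refine le_trans (le_of_eq ?_) (main_estimate k d hd p hp h1)
  refine integral_congr_ae (Eventually.of_forall fun x => ?_)
  have e : gs = fun x => (1 / √(2 * π)) * (fun t : ℝ => Real.exp (-(t ^ 2) / 2)) x := rfl
  simp only []
  rw [uB_deriv k d (by omega) hu1, e, iteratedDeriv_const_mul_field]
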